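/- arXiv:2502.10716 — 2 statements merged into one kernel-verified Lean document; each statement's English description precedes it below -/
import Mathlib

section
/- Let C ≥ 1 and let μ, μ' be probability measures on a measurable space X with measurable conditional label maps p, p' : X → ℝ^C into probability vectors. Let A ⊆ X be measurable with μ(A) > 0 and μ'(A) > 0, and let μ_A = μ|_A and μ'_A = μ'|_A be the conditional measures. Define the subspace label marginals (P_{Y,A})_i = ∫ p(x)_i dμ_A(x) and (P'_{Y,A})_i = ∫ p'(x)_i dμ'_A(x). Let g : X → Z and h : Z → ℝ^C (into probability vectors) be measurable, f = h∘g, and let L_{Hel}(f, μ_A, p) = ∫ [2 ∑_{i=1}^C (√(f(x)_i) − √(p(x)_i))²] dμ_A(x). Then d_{1/2}(P_{Y,A}, P'_{Y,A}) ≤ L_{Hel}(f, μ_A, p)^{1/2} + d_{1/2}(g_#μ_A, g_#μ'_A) + L_{Hel}(f, μ'_A, p')^{1/2}. -/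
open MeasureTheory ProbabilityTheory

/-- Hellinger distance between probability vectors on `{1,…,C}`:
`d_{1/2}(a, b) = (2 ∑ i, (√a_i − √b_i)²)^{1/2}`. -/
noncomputable def hellingerVec {C : ℕ} (a b : Fin C → ℝ) : ℝ :=
  Real.sqrt (2 * ∑ i, (Real.sqrt (a i) - Real.sqrt (b i)) ^ 2)

/-- Hellinger distance between two measures:
`d_{1/2}(μ, ν) = (2 ∫ (√(dμ/dλ) − √(dν/dλ))² dλ)^{1/2}` with `λ = μ + ν`. -/
noncomputable def hellingerDist {Ω : Type*} [MeasurableSpace Ω] (μ ν : Measure Ω) : ℝ :=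
  Real.sqrt (2 * ∫ ω, (Real.sqrt ((μ.rnDeriv (μ + ν) ω).toReal)
      - Real.sqrt ((ν.rnDeriv (μ + ν) ω).toReal)) ^ 2 ∂(μ + ν))

/-- Hellinger loss of a simplex-valued hypothesis `f` with respect to feature
distribution `μ` and conditional label map `p`. -/
noncomputable def hellingerLoss {C : ℕ} {X : Type*} [MeasurableSpace X]
    (f : X → Fin C → ℝ) (μ : Measure X) (p : X → Fin C → ℝ) : ℝ :=
  ∫ x, (2 * ∑ i, (Real.sqrt (f x i) - Real.sqrt (p x i)) ^ 2) ∂μ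

lemma key_sq {Ω : Type*} [MeasurableSpace Ω] (m : Measure Ω) (u v : Ω → ℝ)
    (hu : Integrable u m) (hv : Integrable v m) (hu0 : ∀ x, 0 ≤ u x) (hv0 : ∀ x, 0 ≤ v x) :
    Integrable (fun x => (Real.sqrt (u x) - Real.sqrt (v x)) ^ 2) m ∧
    (Real.sqrt (∫ x, u x ∂m) - Real.sqrt (∫ x, v x ∂m)) ^ 2
      ≤ ∫ x, (Real.sqrt (u x) - Real.sqrt (v x)) ^ 2 ∂m := by
  have hum : MemLp (fun x => Real.sqrt (u x)) 2 m := by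
    rw [memLp_two_iff_integrable_sq
      (Real.continuous_sqrt.comp_aestronglyMeasurable hu.aestronglyMeasurable)]
    simpa only [Real.sq_sqrt (hu0 _)] using hu
  have hvm : MemLp (fun x => Real.sqrt (v x)) 2 m := by
    rw [memLp_two_iff_integrable_sq
      (Real.continuous_sqrt.comp_aestronglyMeasurable hv.aestronglyMeasurable)]
    simpa only [Real.sq_sqrt (hv0 _)] using hv
  have hint : Integrable (fun x => Real.sqrt (u x) * Real.sqrt (v x)) m :=
    hum.integrable_mul hvm
  have cs := integral_mul_le_Lp_mul_Lq_of_nonneg (μ := m) Real.HolderConjugate.two_two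
    (f := fun x => Real.sqrt (u x)) (g := fun x => Real.sqrt (v x))
    (Filter.Eventually.of_forall fun x => Real.sqrt_nonneg _)
    (Filter.Eventually.of_forall fun x => Real.sqrt_nonneg _)
    (by simpa using hum) (by simpa using hvm)
  simp only [Real.rpow_two, Real.sq_sqrt (hu0 _), Real.sq_sqrt (hv0 _),
    ← Real.sqrt_eq_rpow] at cs
  have e : ∀ x, (Real.sqrt (u x) - Real.sqrt (v x)) ^ 2
      = u x + v x - 2 * (Real.sqrt (u x) * Real.sqrt (v x)) := by
    intro x
    rw [sub_sq, Real.sq_sqrt (hu0 x), Real.sq_sqrt (hv0 x)]; ring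
  simp only [e]
  have huv : Integrable (fun x => u x + v x) m := hu.add hv
  refine ⟨huv.sub (hint.const_mul 2), ?_⟩
  rw [integral_sub huv (hint.const_mul 2), integral_add hu hv, integral_const_mul,
    sub_sq, Real.sq_sqrt (integral_nonneg hu0), Real.sq_sqrt (integral_nonneg hv0)]
  linarith

lemma vec_le {Ω : Type*} [MeasurableSpace Ω] (m : Measure Ω) {C : ℕ} (u v : Ω → Fin C → ℝ)
    (hu : ∀ i, Integrable (fun x => u x i) m) (hv : ∀ i, Integrable (fun x => v x i) m)
    (hu0 : ∀ x i, 0 ≤ u x i) (hv0 : ∀ x i, 0 ≤ v x i) :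
    hellingerVec (fun i => ∫ x, u x i ∂m) (fun i => ∫ x, v x i ∂m)
      ≤ Real.sqrt (∫ x, (2 * ∑ i, (Real.sqrt (u x i) - Real.sqrt (v x i)) ^ 2) ∂m) := by
  have k := fun i => key_sq m (fun x => u x i) (fun x => v x i) (hu i) (hv i)
    (fun x => hu0 x i) (fun x => hv0 x i)
  unfold hellingerVec
  apply Real.sqrt_le_sqrt
  rw [integral_const_mul, integral_finsetSum _ fun i _ => (k i).1]
  gcongr with i
  exact (k i).2

lemma vec_eq {C : ℕ} (a b : Fin C → ℝ) : hellingerVec a b = Real.sqrt 2 *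
    dist (WithLp.toLp 2 (fun i => Real.sqrt (a i)) : EuclideanSpace ℝ (Fin C))
      (WithLp.toLp 2 (fun i => Real.sqrt (b i))) := by
  rw [EuclideanSpace.dist_eq, ← Real.sqrt_mul (by norm_num)]
  simp [hellingerVec, Real.dist_eq, sq_abs]

lemma vec_tri {C : ℕ} (a b c : Fin C → ℝ) :
    hellingerVec a c ≤ hellingerVec a b + hellingerVec b c := by
  rw [vec_eq, vec_eq, vec_eq, ← mul_add]
  gcongr
  exact dist_triangle _ _ _

lemma vec_comm {C : ℕ} (a b : Fin C → ℝ) : hellingerVec a b = hellingerVec b a := by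
  rw [vec_eq, vec_eq, dist_comm]

lemma vec_int {Ω : Type*} [MeasurableSpace Ω] (m : Measure Ω) [IsFiniteMeasure m] {C : ℕ}
    (p : Ω → Fin C → ℝ) (hpm : ∀ i, Measurable fun x => p x i)
    (hp0 : ∀ x i, 0 ≤ p x i) (hp1 : ∀ x, ∑ i, p x i = 1) (i : Fin C) :
    Integrable (fun x => p x i) m := by
  refine Integrable.of_bound (hpm i).aestronglyMeasurable 1 (Filter.Eventually.of_forall fun x => ?_)
  rw [Real.norm_of_nonneg (hp0 x i), ← hp1 x]
  exact Finset.single_le_sum (fun j _ => hp0 x j) (Finset.mem_univ i)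

lemma vec_le_dist {Z : Type*} [MeasurableSpace Z] (m n : Measure Z) [IsFiniteMeasure m]
    [IsFiniteMeasure n] {C : ℕ}
    (h : Z → Fin C → ℝ) (hhm : ∀ i, Measurable fun z => h z i)
    (hh0 : ∀ z i, 0 ≤ h z i) (hh1 : ∀ z, ∑ i, h z i = 1) :
    hellingerVec (fun i => ∫ z, h z i ∂m) (fun i => ∫ z, h z i ∂n) ≤ hellingerDist m n := by
  have hm : m ≪ m + n := Measure.AbsolutelyContinuous.rfl.add_right n
  have hn : n ≪ m + n := by
    rw [add_comm]; exact Measure.AbsolutelyContinuous.rfl.add_right m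
  have := vec_le (m + n) (fun z i => (m.rnDeriv (m + n) z).toReal * h z i)
    (fun z i => (n.rnDeriv (m + n) z).toReal * h z i)
    (fun i => (integrable_toReal_rnDeriv_mul_iff hm).2 (vec_int m h hhm hh0 hh1 i))
    (fun i => (integrable_toReal_rnDeriv_mul_iff hn).2 (vec_int n h hhm hh0 hh1 i))
    (fun z i => mul_nonneg ENNReal.toReal_nonneg (hh0 z i))
    (fun z i => mul_nonneg ENNReal.toReal_nonneg (hh0 z i))
  simp only [integral_toReal_rnDeriv_mul hm, integral_toReal_rnDeriv_mul hn] at this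
  refine this.trans_eq ?_
  unfold hellingerDist
  rw [integral_const_mul]
  congr 3
  ext z
  simp only [Real.sqrt_mul ENNReal.toReal_nonneg, ← sub_mul, mul_pow, Real.sq_sqrt (hh0 z _)]
  rw [← Finset.mul_sum, hh1, mul_one]

/-- Theorem 5.2(ii): the label-shift trade-off of representation alignment holds within
each subspace `A`, with the conditional measures `μ|_A` and `μ'|_A`. -/
theorem subspace_label_marginal_hellinger_tradeoff
    (C : ℕ) (hC : 1 ≤ C) {X Z : Type*} [MeasurableSpace X] [MeasurableSpace Z]
    (μ μ' : Measure X) [IsProbabilityMeasure μ] [IsProbabilityMeasure μ']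
    (p p' : X → Fin C → ℝ)
    (hpm : ∀ i, Measurable fun x => p x i) (hp'm : ∀ i, Measurable fun x => p' x i)
    (hp0 : ∀ x i, 0 ≤ p x i) (hp1 : ∀ x, ∑ i, p x i = 1)
    (hp'0 : ∀ x i, 0 ≤ p' x i) (hp'1 : ∀ x, ∑ i, p' x i = 1)
    (A : Set X) (hAmeas : MeasurableSet A) (hApos : 0 < μ A) (hA'pos : 0 < μ' A)
    (g : X → Z) (hg : Measurable g)
    (h : Z → Fin C → ℝ) (hhm : ∀ i, Measurable fun z => h z i)
    (hh0 : ∀ z i, 0 ≤ h z i) (hh1 : ∀ z, ∑ i, h z i = 1) :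
    hellingerVec (fun i => ∫ x, p x i ∂(μ[|A])) (fun i => ∫ x, p' x i ∂(μ'[|A]))
      ≤ Real.sqrt (hellingerLoss (fun x => h (g x)) (μ[|A]) p)
        + hellingerDist (Measure.map g (μ[|A])) (Measure.map g (μ'[|A]))
        + Real.sqrt (hellingerLoss (fun x => h (g x)) (μ'[|A]) p') := by
  haveI := cond_isProbabilityMeasure (μ := μ) hApos.ne'
  haveI := cond_isProbabilityMeasure (μ := μ') hA'pos.ne'
  have i1 := vec_int μ[|A] p hpm hp0 hp1
  have i2 := vec_int μ'[|A] p' hp'm hp'0 hp'1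
  have hfm : ∀ i, Measurable fun x => h (g x) i := fun i => (hhm i).comp hg
  have j1 := vec_int μ[|A] (fun x => h (g x)) hfm (fun x => hh0 (g x)) (fun x => hh1 (g x))
  have j2 := vec_int μ'[|A] (fun x => h (g x)) hfm (fun x => hh0 (g x)) (fun x => hh1 (g x))
  have s1 := vec_le μ[|A] (fun x => h (g x)) p j1 i1 (fun x => hh0 (g x)) hp0
  have s3 := vec_le μ'[|A] (fun x => h (g x)) p' j2 i2 (fun x => hh0 (g x)) hp'0
  have s2 := vec_le_dist (Measure.map g μ[|A]) (Measure.map g μ'[|A]) h hhm hh0 hh1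
  simp only [fun (ν : Measure X) i => integral_map (μ := ν) hg.aemeasurable
    (hhm i).aestronglyMeasurable] at s2
  rw [vec_comm] at s1
  unfold hellingerLoss
  exact (vec_tri _ _ _).trans (add_le_add ((vec_tri _ _ _).trans (add_le_add s1 s2)) s3)
end

section
/- Let μ_1, …, μ_K be probability measures on a product measurable space X × Y, let {A_m}_{m∈M} be a countable measurable partition of X with μ_e(A_m × Y) > 0 for every e ∈ {1,…,K} and m ∈ M, and set π^e_m = μ_e(A_m × Y) and μ_{e,m} = μ_e|_{A_m × Y}. Let g : X → Z and h : Z → S be measurable, f = h∘g, let ℓ : S × Y → ℝ be measurable with 0 ≤ ℓ ≤ L, and let Φ(x, y) = (g(x), y). Then K · ∑_{e=1}^K L(f, μ_e) ≤ ∑_{e=1}^K ∑_{e'=1}^K ∑_{m∈M} π^e_m · L(f, μ_{e',m}) + √2 · L · ∑_{e=1}^K ∑_{e'=1}^K ∑_{m∈M} π^e_m · d_{1/2}(Φ_#μ_{e,m}, Φ_#μ_{e',m}), where L(f, P) = E_{(x,y)∼P}[ℓ(f(x), y)]. -/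
open MeasureTheory ProbabilityTheory

lemma hell_aux {Ω : Type*} [MeasurableSpace Ω] (P Q : Measure Ω)
    [IsProbabilityMeasure P] [IsProbabilityMeasure Q] (F : Ω → ℝ) (hF : Measurable F)
    (L : ℝ) (hF0 : ∀ x, 0 ≤ F x ∧ F x ≤ L) :
    (∫ x, F x ∂P ≤ ∫ x, F x ∂Q + Real.sqrt 2 * L * hellingerDist P Q) ∧
      hellingerDist P Q ≤ 2 := by
  have hP : P ≪ P + Q := Measure.AbsolutelyContinuous.rfl.add_right Q
  have hQ : Q ≪ P + Q := by
    rw [add_comm]; exact Measure.AbsolutelyContinuous.rfl.add_right P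
  have hne : Nonempty Ω := nonempty_of_isProbabilityMeasure P
  have hL : 0 ≤ L := (hF0 hne.some).1.trans (hF0 hne.some).2
  unfold hellingerDist
  have e1 : ∫ x, F x ∂P = ∫ x, (P.rnDeriv (P+Q) x).toReal * F x ∂(P+Q) := by
    rw [← integral_rnDeriv_smul hP]; simp
  have e2 : ∫ x, F x ∂Q = ∫ x, (Q.rnDeriv (P+Q) x).toReal * F x ∂(P+Q) := by
    rw [← integral_rnDeriv_smul hQ]; simp
  have n1 : ∫ x, (P.rnDeriv (P+Q) x).toReal ∂(P+Q) = 1 := by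
    rw [Measure.integral_toReal_rnDeriv hP]; simp
  have n2 : ∫ x, (Q.rnDeriv (P+Q) x).toReal ∂(P+Q) = 1 := by
    rw [Measure.integral_toReal_rnDeriv hQ]; simp
  have i1 : Integrable (fun x => (P.rnDeriv (P+Q) x).toReal) (P+Q) :=
    Measure.integrable_toReal_rnDeriv
  have i2 : Integrable (fun x => (Q.rnDeriv (P+Q) x).toReal) (P+Q) :=
    Measure.integrable_toReal_rnDeriv
  have m1 : Measurable (fun x => (P.rnDeriv (P+Q) x).toReal) :=
    (Measure.measurable_rnDeriv _ _).ennreal_toReal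
  have m2 : Measurable (fun x => (Q.rnDeriv (P+Q) x).toReal) :=
    (Measure.measurable_rnDeriv _ _).ennreal_toReal
  have p0 : ∀ x, 0 ≤ (P.rnDeriv (P+Q) x).toReal := fun x => ENNReal.toReal_nonneg
  have q0 : ∀ x, 0 ≤ (Q.rnDeriv (P+Q) x).toReal := fun x => ENNReal.toReal_nonneg
  rw [e1, e2]
  generalize P + Q = lam at *
  generalize hp : (fun x => (P.rnDeriv lam x).toReal) = p at *
  generalize hq : (fun x => (Q.rnDeriv lam x).toReal) = q at *
  have hp' : ∀ x, (P.rnDeriv lam x).toReal = p x := fun x => congrFun hp x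
  have hq' : ∀ x, (Q.rnDeriv lam x).toReal = q x := fun x => congrFun hq x
  simp only [hp', hq'] at *
  clear e1 e2 hP hQ hp hq hp' hq'
  have sp : ∀ x, Real.sqrt (p x) ^ 2 = p x := fun x => Real.sq_sqrt (p0 x)
  have sq : ∀ x, Real.sqrt (q x) ^ 2 = q x := fun x => Real.sq_sqrt (q0 x)
  have sp0 : ∀ x, 0 ≤ Real.sqrt (p x) := fun x => Real.sqrt_nonneg _
  have sq0 : ∀ x, 0 ≤ Real.sqrt (q x) := fun x => Real.sqrt_nonneg _
  have ms : Measurable (fun x => |Real.sqrt (p x) - Real.sqrt (q x)|) :=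
    (m1.sqrt.sub m2.sqrt).abs
  have ma : Measurable (fun x => Real.sqrt (p x) + Real.sqrt (q x)) :=
    (m1.sqrt.add m2.sqrt)
  have is : Integrable (fun x => (Real.sqrt (p x) - Real.sqrt (q x)) ^ 2) lam := by
    refine (i1.add i2).mono' ((m1.sqrt.sub m2.sqrt).pow_const 2).aestronglyMeasurable ?_
    refine Filter.Eventually.of_forall fun x => ?_
    rw [Real.norm_eq_abs, abs_of_nonneg (by positivity)]
    simp only [Pi.add_apply]
    nlinarith [sp x, sq x, mul_nonneg (sp0 x) (sq0 x)]
  have ia : Integrable (fun x => (Real.sqrt (p x) + Real.sqrt (q x)) ^ 2) lam := by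
    refine ((i1.add i2).const_mul 2).mono' (ma.pow_const 2).aestronglyMeasurable ?_
    refine Filter.Eventually.of_forall fun x => ?_
    rw [Real.norm_eq_abs, abs_of_nonneg (by positivity)]
    simp only [Pi.add_apply]
    nlinarith [sp x, sq x, sq_nonneg (Real.sqrt (p x) - Real.sqrt (q x))]
  have bs : ∫ x, (Real.sqrt (p x) - Real.sqrt (q x)) ^ 2 ∂lam ≤ 2 := by
    calc _ ≤ ∫ x, (p x + q x) ∂lam := by
          refine integral_mono is (i1.add i2) fun x => ?_
          dsimp only
          nlinarith [sp x, sq x, mul_nonneg (sp0 x) (sq0 x)]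
      _ = 2 := by rw [integral_add i1 i2, n1, n2]; norm_num
  have ba : ∫ x, (Real.sqrt (p x) + Real.sqrt (q x)) ^ 2 ∂lam ≤ 4 := by
    calc _ ≤ ∫ x, 2 * (p x + q x) ∂lam := by
          refine integral_mono ia ((i1.add i2).const_mul 2) fun x => ?_
          dsimp only
          nlinarith [sp x, sq x, sq_nonneg (Real.sqrt (p x) - Real.sqrt (q x))]
      _ = 4 := by rw [integral_const_mul, integral_add i1 i2, n1, n2]; norm_num
  refine ⟨?_, ?_⟩
  swap
  · rw [Real.sqrt_le_left (by norm_num)]; linarith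
  have iF : ∀ r : Ω → ℝ, Integrable r lam → Integrable (fun x => r x * F x) lam := by
    intro r hr
    refine hr.mul_bdd (c := L) hF.aestronglyMeasurable (Filter.Eventually.of_forall fun x => ?_)
    rw [Real.norm_eq_abs, abs_of_nonneg (hF0 x).1]; exact (hF0 x).2
  have mls : MemLp (fun x => |Real.sqrt (p x) - Real.sqrt (q x)|) 2 lam := by
    rw [memLp_two_iff_integrable_sq ms.aestronglyMeasurable]; simpa only [sq_abs] using is
  have mla : MemLp (fun x => Real.sqrt (p x) + Real.sqrt (q x)) 2 lam := by
    rw [memLp_two_iff_integrable_sq ma.aestronglyMeasurable]; exact ia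
  have hol := integral_mul_le_Lp_mul_Lq_of_nonneg (μ := lam) Real.HolderConjugate.two_two
    (Filter.Eventually.of_forall fun x => abs_nonneg (Real.sqrt (p x) - Real.sqrt (q x)))
    (Filter.Eventually.of_forall fun x => add_nonneg (sp0 x) (sq0 x))
    (by simpa using mls) (by simpa using mla)
  simp only [Real.rpow_two, sq_abs, ← Real.sqrt_eq_rpow] at hol
  have i3 : Integrable (fun x => |Real.sqrt (p x) - Real.sqrt (q x)| *
      (Real.sqrt (p x) + Real.sqrt (q x))) lam := mls.integrable_mul mla
  have key : ∫ x, p x * F x ∂lam - ∫ x, q x * F x ∂lam ≤ L * ∫ x, |Real.sqrt (p x) - Real.sqrt (q x)| *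
      (Real.sqrt (p x) + Real.sqrt (q x)) ∂lam := by
    rw [← integral_sub (iF p i1) (iF q i2), ← integral_const_mul]
    refine integral_mono ((iF p i1).sub (iF q i2)) (i3.const_mul L) fun x => ?_
    dsimp only
    have a1 : p x - q x = (Real.sqrt (p x) - Real.sqrt (q x)) *
      (Real.sqrt (p x) + Real.sqrt (q x)) := by nlinarith [sp x, sq x]
    rw [← sub_mul, a1]
    have a2 := mul_le_mul_of_nonneg_right (le_abs_self (Real.sqrt (p x) - Real.sqrt (q x)))
      (add_nonneg (sp0 x) (sq0 x))
    have a3 : 0 ≤ |Real.sqrt (p x) - Real.sqrt (q x)| * (Real.sqrt (p x) + Real.sqrt (q x)) :=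
      mul_nonneg (abs_nonneg _) (add_nonneg (sp0 x) (sq0 x))
    calc _ ≤ _ := mul_le_mul_of_nonneg_right a2 (hF0 x).1
      _ ≤ _ := mul_le_mul_of_nonneg_left (hF0 x).2 a3
      _ = _ := mul_comm _ _
  have b4 : Real.sqrt (∫ x, (Real.sqrt (p x) + Real.sqrt (q x)) ^ 2 ∂lam) ≤ 2 := by
    rw [Real.sqrt_le_left (by norm_num)]; linarith
  rw [Real.sqrt_mul (by norm_num)]
  have s2 : Real.sqrt 2 * Real.sqrt 2 = 2 := Real.mul_self_sqrt (by norm_num)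
  have := hol.trans (mul_le_mul_of_nonneg_left b4 (Real.sqrt_nonneg _))
  have h5 := key.trans (mul_le_mul_of_nonneg_left this hL)
  have : ∀ s : ℝ, Real.sqrt 2 * L * (Real.sqrt 2 * s) = L * (s * 2) := fun s => by
    calc _ = (Real.sqrt 2 * Real.sqrt 2) * L * s := by ring
      _ = _ := by rw [s2]; ring
  rw [this]; linarith

/-- Theorem 5.2(i), Subspace Representation Alignment: the sum of training-domain losses
is upper-bounded by the subspace losses plus the subspace-wise Hellinger alignment terms. -/
theorem sum_losses_le_subspace_losses_add_subspace_hellinger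
    (K : ℕ) {X Y Z S : Type*} [MeasurableSpace X] [MeasurableSpace Y]
    [MeasurableSpace Z] [MeasurableSpace S]
    (μ : Fin K → Measure (X × Y)) [∀ e, IsProbabilityMeasure (μ e)]
    {M : Type*} [Countable M] (A : M → Set X)
    (hAmeas : ∀ m, MeasurableSet (A m))
    (hdisj : Pairwise (Function.onFun Disjoint A))
    (hcover : ⋃ m, A m = Set.univ)
    (hpos : ∀ e m, 0 < μ e (A m ×ˢ (Set.univ : Set Y)))
    (g : X → Z) (hg : Measurable g) (h : Z → S) (hh : Measurable h)
    (ℓ : S × Y → ℝ) (hℓmeas : Measurable ℓ)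
    (L : ℝ) (hL : 0 < L) (hℓ : ∀ s y, 0 ≤ ℓ (s, y) ∧ ℓ (s, y) ≤ L) :
    (K : ℝ) * ∑ e, ∫ q, ℓ (h (g q.1), q.2) ∂(μ e)
      ≤ (∑ e, ∑ e', ∑' m, (μ e (A m ×ˢ (Set.univ : Set Y))).toReal *
            ∫ q, ℓ (h (g q.1), q.2) ∂((μ e')[|A m ×ˢ (Set.univ : Set Y)]))
        + Real.sqrt 2 * L *
          ∑ e, ∑ e', ∑' m, (μ e (A m ×ˢ (Set.univ : Set Y))).toReal *
            hellingerDist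
              (Measure.map (fun q : X × Y => (g q.1, q.2))
                ((μ e)[|A m ×ˢ (Set.univ : Set Y)]))
              (Measure.map (fun q : X × Y => (g q.1, q.2))
                ((μ e')[|A m ×ˢ (Set.univ : Set Y)])) := by
  have hB : ∀ m, MeasurableSet (A m ×ˢ (Set.univ : Set Y)) :=
    fun m => (hAmeas m).prod MeasurableSet.univ
  have hBd : Pairwise (Function.onFun Disjoint fun m => A m ×ˢ (Set.univ : Set Y)) :=
    fun i j hij => Set.disjoint_prod.2 (Or.inl (hdisj hij))
  have hBc : ⋃ m, A m ×ˢ (Set.univ : Set Y) = Set.univ := by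
    rw [← Set.iUnion_prod_const, hcover, Set.univ_prod_univ]
  generalize hBdef : (fun m => A m ×ˢ (Set.univ : Set Y)) = B at *
  have hB' : ∀ m, A m ×ˢ (Set.univ : Set Y) = B m := fun m => congrFun hBdef m
  simp only [hB'] at *
  have hΦ : Measurable (fun q : X × Y => (g q.1, q.2)) :=
    (hg.comp measurable_fst).prodMk measurable_snd
  have hG : Measurable (fun w : Z × Y => ℓ (h w.1, w.2)) :=
    hℓmeas.comp ((hh.comp measurable_fst).prodMk measurable_snd)
  have hF : Measurable (fun q : X × Y => ℓ (h (g q.1), q.2)) := hG.comp hΦ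
  have hFi : ∀ (ν : Measure (X × Y)) [IsFiniteMeasure ν],
      Integrable (fun q : X × Y => ℓ (h (g q.1), q.2)) ν := fun ν _ =>
    Integrable.of_bound hF.aestronglyMeasurable L (Filter.Eventually.of_forall fun q => by
      rw [Real.norm_eq_abs, abs_of_nonneg (hℓ _ _).1]; exact (hℓ _ _).2)
  have hpr : ∀ e m, IsProbabilityMeasure ((μ e)[|B m]) := fun e m =>
    cond_isProbabilityMeasure (hpos e m).ne'
  have hpr' : ∀ e m, IsProbabilityMeasure
      (Measure.map (fun q : X × Y => (g q.1, q.2)) ((μ e)[|B m])) := fun e m =>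
    Measure.isProbabilityMeasure_map hΦ.aemeasurable
  have hπ : ∀ e, Summable fun m => (μ e (B m)).toReal := fun e => by
    apply ENNReal.summable_toReal
    rw [← measure_iUnion hBd hB]
    exact measure_ne_top _ _
  have hterm : ∀ e m, (μ e (B m)).toReal * ∫ q, ℓ (h (g q.1), q.2) ∂((μ e)[|B m])
      = ∫ q in B m, ℓ (h (g q.1), q.2) ∂(μ e) := fun e m => by
    rw [ProbabilityTheory.cond, integral_smul_measure, smul_eq_mul, ← mul_assoc, ENNReal.toReal_inv,
      mul_inv_cancel₀, one_mul]
    exact (ENNReal.toReal_pos (hpos e m).ne' (measure_ne_top _ _)).ne'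
  have hdec : ∀ e, ∫ q, ℓ (h (g q.1), q.2) ∂(μ e)
      = ∑' m, (μ e (B m)).toReal * ∫ q, ℓ (h (g q.1), q.2) ∂((μ e)[|B m]) := fun e => by
    simp only [hterm]
    rw [← integral_iUnion hB hBd (hFi _).integrableOn, hBc, Measure.restrict_univ]
  have hI0 : ∀ e m, 0 ≤ ∫ q, ℓ (h (g q.1), q.2) ∂((μ e)[|B m]) := fun e m =>
    integral_nonneg fun q => (hℓ _ _).1
  have hIL : ∀ e m, ∫ q, ℓ (h (g q.1), q.2) ∂((μ e)[|B m]) ≤ L := fun e m => by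
    calc _ ≤ ∫ q, L ∂((μ e)[|B m]) :=
          integral_mono (hFi _) (integrable_const L) fun q => (hℓ _ _).2
      _ = L := by simp
  have hsum : ∀ e (c : M → ℝ) (C : ℝ), (∀ m, 0 ≤ c m ∧ c m ≤ C) →
      Summable fun m => (μ e (B m)).toReal * c m := fun e c C hc =>
    Summable.of_nonneg_of_le (fun m => mul_nonneg ENNReal.toReal_nonneg (hc m).1)
      (fun m => mul_le_mul_of_nonneg_left (hc m).2 ENNReal.toReal_nonneg) ((hπ e).mul_right C)
  have haux := fun e e' m => hell_aux
    (Measure.map (fun q : X × Y => (g q.1, q.2)) ((μ e)[|B m]))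
    (Measure.map (fun q : X × Y => (g q.1, q.2)) ((μ e')[|B m]))
    (fun w : Z × Y => ℓ (h w.1, w.2)) hG L (fun w => hℓ _ _)
  simp only [integral_map hΦ.aemeasurable hG.aestronglyMeasurable] at haux
  have hmain : ∀ e e', ∫ q, ℓ (h (g q.1), q.2) ∂(μ e) ≤
      (∑' m, (μ e (B m)).toReal * ∫ q, ℓ (h (g q.1), q.2) ∂((μ e')[|B m])) +
      Real.sqrt 2 * L * ∑' m, (μ e (B m)).toReal * hellingerDist
        (Measure.map (fun q : X × Y => (g q.1, q.2)) ((μ e)[|B m]))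
        (Measure.map (fun q : X × Y => (g q.1, q.2)) ((μ e')[|B m])) := fun e e' => by
    have s1 := hsum e _ L fun m => ⟨hI0 e m, hIL e m⟩
    have s2 := hsum e _ L fun m => ⟨hI0 e' m, hIL e' m⟩
    have s3 := (hsum e (fun m => hellingerDist
        (Measure.map (fun q : X × Y => (g q.1, q.2)) ((μ e)[|B m]))
        (Measure.map (fun q : X × Y => (g q.1, q.2)) ((μ e')[|B m]))) 2
        fun m => ⟨Real.sqrt_nonneg _, (haux e e' m).2⟩).mul_left
      (Real.sqrt 2 * L)
    rw [hdec e, ← tsum_mul_left, ← s2.tsum_add s3]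
    refine s1.tsum_le_tsum (fun m => ?_) (s2.add s3)
    have := mul_le_mul_of_nonneg_left (haux e e' m).1
      (ENNReal.toReal_nonneg (a := μ e (B m)))
    refine this.trans (le_of_eq ?_)
    ring
  calc _ = ∑ e, ∑ e' : Fin K, ∫ q, ℓ (h (g q.1), q.2) ∂(μ e) := by
        simp [Finset.mul_sum]
    _ ≤ _ := Finset.sum_le_sum fun e _ => Finset.sum_le_sum fun e' _ => hmain e e'
    _ = _ := by simp only [Finset.sum_add_distrib, Finset.mul_sum]
end
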